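/- arXiv:math/0307195 — 3 statements merged into one kernel-verified Lean document; each statement's English description precedes it below -/
import Mathlib

section
/- Let (V,q) be a quadratic space over ℚ₂ of dimension d ≥ 3. If L and M are two odd unimodular lattices in (V,q), then there is an isometry of (V,q) (a ℚ₂-linear automorphism g of V with q(g x) = q(x) for all x) carrying L onto M. In particular, there is at most one isomorphism class of odd unimodular lattices in (V,q). -/
/-- The symmetric bilinear form `B_q(x,y) = (q(x+y) - q(x) - q(y))/2` associated to a
quadratic form `q` on a `ℚ₂`-vector space `V`. -/
noncomputable def Bq {V : Type*} [AddCommGroup V] [Module ℚ_[2] V]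
    (q : QuadraticForm ℚ_[2] V) (x y : V) : ℚ_[2] :=
  (q (x + y) - q x - q y) / 2

/-- An element `c : ℚ₂` lies in `ℤ₂ ⊆ ℚ₂` iff its 2-adic norm is at most 1. -/
def IsIntegral2 (c : ℚ_[2]) : Prop := ‖c‖ ≤ 1

/-- A lattice in a `ℚ₂`-vector space `V`: a finitely generated `ℤ₂`-submodule
that spans `V` over `ℚ₂`. -/
def IsLattice {V : Type*} [AddCommGroup V] [Module ℚ_[2] V] [Module ℤ_[2] V]
    [IsScalarTower ℤ_[2] ℚ_[2] V] (L : Submodule ℤ_[2] V) : Prop :=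
  L.FG ∧ Submodule.span ℚ_[2] (L : Set V) = ⊤

/-- `x` lies in the dual lattice `L* = {x ∈ V : B_q(x, L) ⊆ ℤ₂}` of `L`. -/
def InDual {V : Type*} [AddCommGroup V] [Module ℚ_[2] V] [Module ℤ_[2] V]
    [IsScalarTower ℤ_[2] ℚ_[2] V] (q : QuadraticForm ℚ_[2] V) (L : Submodule ℤ_[2] V)
    (x : V) : Prop :=
  ∀ y ∈ L, IsIntegral2 (Bq q x y)

/-- `L` is unimodular: the dual lattice `L*` equals `L`. -/
def IsUnimodular {V : Type*} [AddCommGroup V] [Module ℚ_[2] V] [Module ℤ_[2] V]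
    [IsScalarTower ℤ_[2] ℚ_[2] V] (q : QuadraticForm ℚ_[2] V) (L : Submodule ℤ_[2] V) : Prop :=
  ∀ x : V, InDual q L x ↔ x ∈ L

/-- A lattice `L` is even when `q(L) ⊆ 2ℤ₂`; a unimodular lattice is odd when it is not even. -/
def IsEvenLat {V : Type*} [AddCommGroup V] [Module ℚ_[2] V] [Module ℤ_[2] V]
    [IsScalarTower ℤ_[2] ℚ_[2] V] (q : QuadraticForm ℚ_[2] V) (L : Submodule ℤ_[2] V) : Prop :=
  ∀ x ∈ L, IsIntegral2 (q x / 2)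


section Bilinear

variable {V : Type*} [AddCommGroup V] [Module ℚ_[2] V] (q : QuadraticForm ℚ_[2] V)

theorem Bq_eq_associated (x y : V) : Bq q x y = QuadraticMap.associated q x y := by
  rw [QuadraticMap.associated_apply, Bq, Module.End.smul_def]
  simp [div_eq_inv_mul]

theorem Bq_self (x : V) : Bq q x x = q x := by
  rw [Bq_eq_associated, QuadraticMap.associated_eq_self_apply]

theorem Bq_comm (x y : V) : Bq q x y = Bq q y x := by
  rw [Bq, Bq, add_comm x y]; ring

theorem Bq_add_left (x y z : V) : Bq q (x + y) z = Bq q x z + Bq q y z := by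
  simp [Bq_eq_associated]

theorem Bq_sub_left (x y z : V) : Bq q (x - y) z = Bq q x z - Bq q y z := by
  simp [Bq_eq_associated]

theorem Bq_smul_left (a : ℚ_[2]) (x y : V) : Bq q (a • x) y = a * Bq q x y := by
  simp [Bq_eq_associated]

theorem Bq_add_right (x y z : V) : Bq q x (y + z) = Bq q x y + Bq q x z := by
  simp [Bq_eq_associated]

theorem Bq_sub_right (x y z : V) : Bq q x (y - z) = Bq q x y - Bq q x z := by
  simp [Bq_eq_associated]

theorem Bq_smul_right (a : ℚ_[2]) (x y : V) : Bq q x (a • y) = a * Bq q x y := by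
  simp [Bq_eq_associated]

theorem map_add_eq_add_two_mul_Bq (x y : V) : q (x + y) = q x + q y + 2 * Bq q x y := by
  rw [Bq]; ring

theorem map_sub_eq_add_sub_two_mul_Bq (x y : V) : q (x - y) = q x + q y - 2 * Bq q x y := by
  simp only [← Bq_self q, Bq_sub_left, Bq_sub_right, Bq_comm q y x]; ring

theorem quadraticForm_smul (a : ℚ_[2]) (x : V) : q (a • x) = a * a * q x := by
  rw [QuadraticMap.map_smul, smul_eq_mul]

theorem Bq_map_of_isometry {V' : Type*} [AddCommGroup V'] [Module ℚ_[2] V']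
    {q' : QuadraticForm ℚ_[2] V'} {φ : V →ₗ[ℚ_[2]] V'} (hφ : ∀ v, q' (φ v) = q v) (x y : V) :
    Bq q' (φ x) (φ y) = Bq q x y := by
  rw [Bq, Bq, ← map_add, hφ, hφ, hφ]

/-- The orthogonal complement of a vector. -/
noncomputable def orthVec (x : V) : Submodule ℚ_[2] V :=
  LinearMap.ker (QuadraticMap.associated q x)

theorem mem_orthVec {x y : V} : y ∈ orthVec q x ↔ Bq q x y = 0 := by
  rw [orthVec, LinearMap.mem_ker, Bq_eq_associated]

theorem finrank_orthVec [FiniteDimensional ℚ_[2] V] {x : V} (hx : q x ≠ 0) :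
    Module.finrank ℚ_[2] (orthVec q x) + 1 = Module.finrank ℚ_[2] V := by
  refine Module.Dual.finrank_ker_add_one_of_ne_zero (f := QuadraticMap.associated q x) ?_
  intro h
  apply hx
  rw [← Bq_self, Bq_eq_associated, h, LinearMap.zero_apply]

/-- The restriction of `q` to the orthogonal complement of a vector. -/
noncomputable def orthForm (x : V) : QuadraticForm ℚ_[2] (orthVec q x) :=
  q.comp (orthVec q x).subtype

@[simp]
theorem orthForm_apply (x : V) (v : orthVec q x) : orthForm q x v = q v := rfl

@[simp]
theorem Bq_orthForm (x : V) (v w : orthVec q x) : Bq (orthForm q x) v w = Bq q v w := rfl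

/-- Orthogonal projection to the complement of an anisotropic vector. -/
noncomputable def orthProj (x : V) (hx : q x ≠ 0) : V →ₗ[ℚ_[2]] orthVec q x :=
  LinearMap.codRestrict _
    (LinearMap.id - (q x)⁻¹ • (QuadraticMap.associated q x).smulRight x) fun v => by
      rw [mem_orthVec]
      simp only [LinearMap.sub_apply, LinearMap.id_apply, LinearMap.smul_apply,
        LinearMap.smulRight_apply, Bq_sub_right, Bq_smul_right, Bq_self, ← Bq_eq_associated]
      field_simp
      ring

theorem coe_orthProj (x : V) (hx : q x ≠ 0) (v : V) :
    (orthProj q x hx v : V) = v - ((q x)⁻¹ * Bq q x v) • x := by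
  simp [orthProj, ← Bq_eq_associated, smul_smul]

theorem map_eq_of_orthProj (x : V) (hx : q x ≠ 0) (v : V) :
    q v = ((q x)⁻¹ * Bq q x v) * Bq q x v + q (orthProj q x hx v) := by
  rw [coe_orthProj, map_sub_eq_add_sub_two_mul_Bq, quadraticForm_smul, Bq_smul_right, Bq_comm q v x]
  field_simp
  ring

/-- The reflection in an anisotropic vector. -/
noncomputable def reflVec (w : V) : V →ₗ[ℚ_[2]] V :=
  LinearMap.id - (2 * (q w)⁻¹) • (QuadraticMap.associated q w).smulRight w

theorem reflVec_apply (w v : V) : reflVec q w v = v - (2 * (q w)⁻¹ * Bq q w v) • w := by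
  simp [reflVec, ← Bq_eq_associated, smul_smul]

theorem map_reflVec {w : V} (hw : q w ≠ 0) (v : V) : q (reflVec q w v) = q v := by
  rw [reflVec_apply, map_sub_eq_add_sub_two_mul_Bq, quadraticForm_smul, Bq_smul_right, Bq_comm q v w]
  field_simp
  ring

/-- Isometries act transitively on the vectors of a given nonzero length. -/
theorem exists_isometry_map_eq {x y : V} (hx : q x ≠ 0) (hxy : q x = q y) :
    ∃ τ : V →ₗ[ℚ_[2]] V, (∀ v, q (τ v) = q v) ∧ τ x = y := by
  by_cases h : q (x - y) = 0
  · have h' : q (x + y) ≠ 0 := by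
      have e1 := map_sub_eq_add_sub_two_mul_Bq q x y
      have e2 := map_add_eq_add_two_mul_Bq q x y
      have : q (x + y) = 4 * q x := by linear_combination e1 + e2 - h - 2 * hxy
      rw [this]
      exact mul_ne_zero (by norm_num) hx
    refine ⟨-reflVec q (x + y), fun v => ?_, ?_⟩
    · rw [LinearMap.neg_apply, QuadraticMap.map_neg, map_reflVec q h']
    · have : 2 * (q (x + y))⁻¹ * Bq q (x + y) x = 1 := by
        field_simp
        rw [Bq_add_left, Bq_self, map_add_eq_add_two_mul_Bq, Bq_comm q y x, ← hxy]
        ring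
      rw [LinearMap.neg_apply, reflVec_apply, this]
      module
  · refine ⟨reflVec q (x - y), map_reflVec q h, ?_⟩
    have : 2 * (q (x - y))⁻¹ * Bq q (x - y) x = 1 := by
      field_simp
      rw [Bq_sub_left, Bq_self, map_sub_eq_add_sub_two_mul_Bq, Bq_comm q y x, ← hxy]
      ring
    rw [reflVec_apply, this]
    module

/-- An orthogonal family of anisotropic vectors of full size, as a basis. -/
theorem exists_basis_of_orthogonal {n : ℕ} (e : Fin (n + 1) → V)
    (hn : Module.finrank ℚ_[2] V = n + 1) (ho : ∀ i j, i ≠ j → Bq q (e i) (e j) = 0)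
    (hne : ∀ i, q (e i) ≠ 0) : ∃ b : Module.Basis (Fin (n + 1)) ℚ_[2] V, ⇑b = e := by
  have hli : LinearIndependent ℚ_[2] e := by
    refine LinearMap.BilinForm.linearIndependent_of_iIsOrtho
      (B := QuadraticMap.associated q) ?_ fun i => ?_
    · intro i j hij
      exact (Bq_eq_associated q (e i) (e j)).symm.trans (ho i j hij)
    · rw [← Bq_eq_associated, Bq_self]
      exact hne i
  exact ⟨basisOfLinearIndependentOfCardEqFinrank hli (by simp [hn]), by simp⟩

theorem exists_sq_mul_prod_eq_of_orthogonal {n : ℕ} (e f : Fin (n + 1) → V)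
    (hn : Module.finrank ℚ_[2] V = n + 1) (heo : ∀ i j, i ≠ j → Bq q (e i) (e j) = 0)
    (hfo : ∀ i j, i ≠ j → Bq q (f i) (f j) = 0)
    (he : ∀ i, q (e i) ≠ 0) (hf : ∀ i, q (f i) ≠ 0) :
    ∃ p : ℚ_[2], p * p * ∏ i, q (e i) = ∏ i, q (f i) := by
  obtain ⟨b, rfl⟩ := exists_basis_of_orthogonal q e hn heo he
  obtain ⟨c, rfl⟩ := exists_basis_of_orthogonal q f hn hfo hf
  have key : ∀ b : Module.Basis (Fin (n + 1)) ℚ_[2] V, (∀ i j, i ≠ j → Bq q (b i) (b j) = 0) →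
      (LinearMap.BilinForm.toMatrix b (QuadraticMap.associated q)).det = ∏ i, q (b i) := by
    intro b hb
    rw [← Matrix.det_diagonal]
    congr 1
    ext i j
    rw [LinearMap.BilinForm.toMatrix_apply, ← Bq_eq_associated]
    by_cases hij : i = j
    · subst hij
      rw [Bq_self, Matrix.diagonal_apply_eq]
    · rw [hb i j hij, Matrix.diagonal_apply_ne _ hij]
  refine ⟨(b.toMatrix c).det, ?_⟩
  rw [← key b heo, ← key c hfo,
    ← LinearMap.BilinForm.toMatrix_mul_basis_toMatrix b c (QuadraticMap.associated q),
    Matrix.det_mul, Matrix.det_mul, Matrix.det_transpose]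
  ring

theorem Bq_triple_eq_zero {a b c : V} (hab : Bq q a b = 0) (hac : Bq q a c = 0)
    (hbc : Bq q b c = 0) (i j : Fin 3) (hij : i ≠ j) :
    Bq q (![a, b, c] i) (![a, b, c] j) = 0 := by
  fin_cases i <;> fin_cases j <;> first | exact absurd rfl hij | skip
  · exact hab
  · exact hac
  · exact (Bq_comm _ _ _).trans hab
  · exact hbc
  · exact (Bq_comm _ _ _).trans hac
  · exact (Bq_comm _ _ _).trans hbc

end Bilinear

section Arithmetic

open Polynomial in
theorem PadicInt.exists_sq_mul_eq_of_toZModPow_eq {a u : ℤ_[2]} (ha : IsUnit a)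
    (h : PadicInt.toZModPow 3 a = PadicInt.toZModPow 3 u) : ∃ s : ℤ_[2], s * s * a = u := by
  obtain ⟨a, rfl⟩ := ha
  have hmem : 1 - ↑a⁻¹ * u ∈ RingHom.ker (PadicInt.toZModPow 3 : ℤ_[2] →+* _) := by
    rw [RingHom.mem_ker, map_sub, map_one, map_mul, ← h, ← map_mul, Units.inv_mul, map_one,
      sub_self]
  rw [PadicInt.ker_toZModPow, ← PadicInt.norm_le_pow_iff_mem_span_pow] at hmem
  have h2 : ‖(2 : ℤ_[2])‖ = 2⁻¹ := by simpa using PadicInt.norm_p (p := 2)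
  obtain ⟨s, hs, -⟩ := hensels_lemma (p := 2) (R := ℤ_[2]) (F := X ^ 2 - C (↑a⁻¹ * u)) (a := 1) (by
    have e1 : aeval (1 : ℤ_[2]) (X ^ 2 - C (↑a⁻¹ * u)) = 1 - ↑a⁻¹ * u := by simp
    have e2 : aeval (1 : ℤ_[2]) (derivative (X ^ 2 - C (↑a⁻¹ * u))) = 2 := by
      simp [one_add_one_eq_two]
    rw [e1, e2, h2]
    refine hmem.trans_lt ?_
    norm_num)
  refine ⟨s, ?_⟩
  have hs' : s ^ 2 - ↑a⁻¹ * u = 0 := by simpa using hs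
  linear_combination (a : ℤ_[2]) * hs' + u * a.mul_inv

theorem ZMod.two_mul_eq_or_eq_neg_of_isUnit (a b : ZMod (2 ^ 3)) (ha : IsUnit a) (hb : IsUnit b) :
    2 * a = 2 * b ∨ 2 * a = -(2 * b) := by
  revert a b; decide

theorem ZMod.eq_or_add_four_mul_eq (a b u : ZMod (2 ^ 3)) (hb : IsUnit b)
    (h : 2 * a = 2 * u) : a = u ∨ a + 4 * b = u := by
  revert a b u; decide

theorem ZMod.two_mul_mul_one_add_sq_add_sq_ne_zero (c s t : ZMod (2 ^ 3)) (hc : IsUnit c) :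
    2 * c * (1 + s * s + t * t) ≠ 0 := by
  revert c s t; decide

theorem ZMod.two_mul_cube_mul_one_add_sq_ne_zero (c p : ZMod (2 ^ 3)) (hc : IsUnit c)
    (hp : IsUnit p) : 2 * c ^ 3 * (1 + p * p) ≠ 0 := by
  revert c p; decide

theorem ZMod.four_mul_ne_zero_of_isUnit (c : ZMod (2 ^ 3)) (hc : IsUnit c) : 4 * c ≠ 0 := by
  revert c; decide

theorem ZMod.two_mul_three_ne (c t : ZMod (2 ^ 3)) (hc : IsUnit c) : -(6 * c) ≠ 4 * t := by
  revert c t; decide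

theorem PadicInt.exists_coe_eq {c : ℚ_[2]} (h : ‖c‖ ≤ 1) : ∃ t : ℤ_[2], (t : ℚ_[2]) = c :=
  ⟨⟨c, h⟩, rfl⟩

theorem PadicInt.exists_isUnit_coe_eq {c : ℚ_[2]} (h : ‖c‖ = 1) :
    ∃ t : ℤ_[2], IsUnit t ∧ (t : ℚ_[2]) = c :=
  ⟨⟨c, h.le⟩, PadicInt.isUnit_iff.2 h, rfl⟩

/-- `a ≡ -c` modulo `4`, phrased in `ℤ/8`. -/
def NegModFour (a c : ℤ_[2]) : Prop :=
  2 * PadicInt.toZModPow 3 a = -(2 * PadicInt.toZModPow 3 c)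

theorem NegModFour.binary_ne_of_norm_le {a b c : ℤ_[2]} (hc : IsUnit c)
    (hac : NegModFour a c) (hbc : NegModFour b c) {x y z : ℚ_[2]} (hx : x ≠ 0)
    (hyx : ‖y‖ ≤ ‖x‖) (hzx : ‖z‖ ≤ ‖x‖) : x * x * a + y * y * b ≠ z * z * c := by
  intro h
  have key : ∀ w : ℚ_[2], ‖w‖ ≤ ‖x‖ → ∃ t : ℤ_[2], (t : ℚ_[2]) = w / x := fun w hw =>
    PadicInt.exists_coe_eq (by rw [norm_div]; exact div_le_one_of_le₀ hw (norm_nonneg _))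
  obtain ⟨s, hs⟩ := key y hyx
  obtain ⟨t, ht⟩ := key z hzx
  have h' : a + s * s * b = t * t * c := by
    apply Subtype.coe_injective
    push_cast
    rw [hs, ht]
    field_simp
    linear_combination h
  have h8 := congrArg (PadicInt.toZModPow 3) h'
  simp only [map_add, map_mul] at h8
  refine ZMod.two_mul_mul_one_add_sq_add_sq_ne_zero _ (PadicInt.toZModPow 3 s)
    (PadicInt.toZModPow 3 t) (hc.map (PadicInt.toZModPow 3)) ?_
  unfold NegModFour at hac hbc
  linear_combination (-2) * h8 + hac + (PadicInt.toZModPow 3 s) ^ 2 * hbc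

theorem NegModFour.binary_ne_of_integral {a b c : ℤ_[2]} (hc : IsUnit c)
    (hac : NegModFour a c) (hbc : NegModFour b c) (s t : ℤ_[2]) : s * s * a + t * t * b ≠ c := by
  intro h
  have h8 := congrArg (PadicInt.toZModPow 3) h
  simp only [map_add, map_mul] at h8
  refine ZMod.two_mul_mul_one_add_sq_add_sq_ne_zero _ (PadicInt.toZModPow 3 s)
    (PadicInt.toZModPow 3 t) (hc.map (PadicInt.toZModPow 3)) ?_
  unfold NegModFour at hac hbc
  linear_combination (-2) * h8 + (PadicInt.toZModPow 3 s) ^ 2 * hac +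
    (PadicInt.toZModPow 3 t) ^ 2 * hbc

theorem NegModFour.binary_ne {a b c : ℤ_[2]} (hc : IsUnit c)
    (hac : NegModFour a c) (hbc : NegModFour b c) (x y : ℚ_[2]) : x * x * a + y * y * b ≠ c := by
  intro h
  by_cases h1 : ‖x‖ ≤ 1 ∧ ‖y‖ ≤ 1
  · obtain ⟨s, rfl⟩ := PadicInt.exists_coe_eq h1.1
    obtain ⟨t, rfl⟩ := PadicInt.exists_coe_eq h1.2
    exact NegModFour.binary_ne_of_integral hc hac hbc s t (Subtype.coe_injective (by exact_mod_cast h))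
  rcases le_total ‖y‖ ‖x‖ with hyx | hyx
  · have hx : 1 < ‖x‖ := by
      by_contra! hx
      exact h1 ⟨hx, hyx.trans hx⟩
    exact hac.binary_ne_of_norm_le hc hbc (norm_pos_iff.1 (one_pos.trans hx)) hyx (z := 1)
      (by simpa using hx.le) (by linear_combination h)
  · have hy : 1 < ‖y‖ := by
      by_contra! hy
      exact h1 ⟨hyx.trans hy, hy⟩
    exact hbc.binary_ne_of_norm_le hc hac (norm_pos_iff.1 (one_pos.trans hy)) hyx (z := 1)
      (by simpa using hy.le) (by linear_combination h)

theorem NegModFour.ternary_det_ne {a c : Fin 3 → ℤ_[2]} (ha : ∀ i, IsUnit (a i))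
    (hc : ∀ i, IsUnit (c i)) (h : ∀ i j, NegModFour (a i) (c j)) (p : ℚ_[2]) :
    p * p * (a 0 * a 1 * a 2 : ℤ_[2]) ≠ (c 0 * c 1 * c 2 : ℤ_[2]) := by
  intro hp
  have h1 : ∀ t : ℤ_[2], IsUnit t → ‖(t : ℚ_[2])‖ = 1 := fun t ht => PadicInt.isUnit_iff.1 ht
  have hpn : ‖p‖ = 1 := by
    have := congrArg norm hp
    rw [norm_mul, norm_mul, h1 _ (((ha 0).mul (ha 1)).mul (ha 2)),
      h1 _ (((hc 0).mul (hc 1)).mul (hc 2)), mul_one] at this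
    nlinarith [norm_nonneg p]
  obtain ⟨p, hpu, rfl⟩ := PadicInt.exists_isUnit_coe_eq hpn
  have h' : p * p * (a 0 * a 1 * a 2) = c 0 * c 1 * c 2 := by
    apply Subtype.coe_injective
    push_cast at hp ⊢
    exact hp
  have h8 := congrArg (PadicInt.toZModPow 3) h'
  simp only [map_mul] at h8
  refine ZMod.two_mul_cube_mul_one_add_sq_ne_zero _ _ ((hc 0).map (PadicInt.toZModPow 3))
    (hpu.map (PadicInt.toZModPow 3)) ?_
  unfold NegModFour at h
  generalize PadicInt.toZModPow 3 p = p' at *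
  have e0 := h 0 0
  have e1 := h 1 0
  have e2 := h 2 0
  have f1 := h 0 1
  have f2 := h 0 2
  generalize PadicInt.toZModPow 3 (a 0) = a0 at *
  generalize PadicInt.toZModPow 3 (a 1) = a1 at *
  generalize PadicInt.toZModPow 3 (a 2) = a2 at *
  generalize PadicInt.toZModPow 3 (c 0) = c0 at *
  generalize PadicInt.toZModPow 3 (c 1) = c1 at *
  generalize PadicInt.toZModPow 3 (c 2) = c2 at *
  have g1 : 2 * c1 = 2 * c0 := by linear_combination f1 - e0
  have g2 : 2 * c2 = 2 * c0 := by linear_combination f2 - e0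
  linear_combination (-2) * h8 + p' ^ 2 * (a1 * a2 * e0 - c0 * a2 * e1 + c0 ^ 2 * e2)
    - c0 * c2 * g1 - c0 ^ 2 * g2

theorem NegModFour.not_sum_three {a b d c : ℤ_[2]} (hc : IsUnit c) (hac : NegModFour a c)
    (hbc : NegModFour b c) (hdc : NegModFour d c) : ¬ NegModFour (a + b + d) c := by
  intro h
  refine ZMod.four_mul_ne_zero_of_isUnit _ (hc.map (PadicInt.toZModPow 3)) ?_
  unfold NegModFour at *
  simp only [map_add] at h
  linear_combination hac + hbc + hdc - h

theorem NegModFour.isUnit_sum_three {a b d c : ℤ_[2]} (hc : IsUnit c) (hac : NegModFour a c)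
    (hbc : NegModFour b c) (hdc : NegModFour d c) : IsUnit (a + b + d) := by
  by_contra h
  rw [PadicInt.isUnit_iff] at h
  obtain ⟨t, ht⟩ := (PadicInt.norm_lt_one_iff_dvd _).1 (lt_of_le_of_ne (a + b + d).2 h)
  have h8 := congrArg (PadicInt.toZModPow 3) ht
  simp only [map_add, map_mul, Nat.cast_ofNat, map_ofNat] at h8
  refine ZMod.two_mul_three_ne (PadicInt.toZModPow 3 c) (PadicInt.toZModPow 3 t)
    (hc.map (PadicInt.toZModPow 3)) ?_
  unfold NegModFour at hac hbc hdc
  linear_combination 2 * h8 - hac - hbc - hdc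

end Arithmetic

section Norm

theorem PadicInt.coe_ofNat' (n : ℕ) [n.AtLeastTwo] :
    ((OfNat.ofNat n : ℤ_[2]) : ℚ_[2]) = OfNat.ofNat n :=
  map_ofNat PadicInt.Coe.ringHom n

theorem padic_norm_add_eq_one {a b : ℚ_[2]} (ha : ‖a‖ = 1) (hb : ‖b‖ < 1) : ‖a + b‖ = 1 := by
  rw [Padic.add_eq_max_of_ne (by rw [ha]; exact hb.ne'), ha, max_eq_left hb.le]

theorem padic_norm_two : ‖(2 : ℚ_[2])‖ = 2⁻¹ := by
  simpa using Padic.norm_p (p := 2)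

theorem padic_norm_half_mul_le_one {c : ℚ_[2]} (hc : ‖c‖ < 1) : ‖2⁻¹ * c‖ ≤ 1 := by
  obtain ⟨t, rfl⟩ := PadicInt.exists_coe_eq hc.le
  obtain ⟨s, hs⟩ := (PadicInt.norm_lt_one_iff_dvd t).1 hc
  have : (2 : ℚ_[2])⁻¹ * t = s := by
    rw [hs, PadicInt.coe_mul, Nat.cast_ofNat, PadicInt.coe_ofNat']
    field_simp
  rw [this]
  exact s.2

end Norm

section Lattice

variable {V : Type*} [AddCommGroup V] [Module ℚ_[2] V] [Module ℤ_[2] V]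
  [IsScalarTower ℤ_[2] ℚ_[2] V]

theorem Submodule.padic_smul_mem (L : Submodule ℤ_[2] V) {c : ℚ_[2]} (hc : ‖c‖ ≤ 1) {v : V}
    (hv : v ∈ L) : c • v ∈ L := by
  obtain ⟨t, rfl⟩ := PadicInt.exists_coe_eq hc
  rw [← PadicInt.algebraMap_apply, algebraMap_smul]
  exact L.smul_mem t hv

/-- The conditions on a unimodular lattice in a nondegenerate space in the form used for the
descent to orthogonal complements. -/
structure IsUnimodularLattice (q : QuadraticForm ℚ_[2] V) (L : Submodule ℤ_[2] V) : Prop where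
  nondegenerate : ∀ x : V, (∀ y : V, Bq q x y = 0) → x = 0
  absorbs : ∀ v : V, ∃ k : ℕ, (2 : ℚ_[2]) ^ k • v ∈ L
  unimodular : IsUnimodular q L

/-- The intersection of a lattice with the orthogonal complement of a vector. -/
noncomputable def orthLattice (q : QuadraticForm ℚ_[2] V) (L : Submodule ℤ_[2] V) (x : V) :
    Submodule ℤ_[2] (orthVec q x) :=
  L.comap ((orthVec q x).subtype.restrictScalars ℤ_[2])

theorem mem_orthLattice {q : QuadraticForm ℚ_[2] V} {L : Submodule ℤ_[2] V} {x : V}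
    {v : orthVec q x} : v ∈ orthLattice q L x ↔ (v : V) ∈ L := Iff.rfl

theorem Submodule.absorbs_of_span_eq_top {L : Submodule ℤ_[2] V}
    (h : Submodule.span ℚ_[2] (L : Set V) = ⊤) (v : V) : ∃ k : ℕ, (2 : ℚ_[2]) ^ k • v ∈ L := by
  have hv : v ∈ Submodule.span ℚ_[2] (L : Set V) := h ▸ Submodule.mem_top
  have h2 : ∀ k : ℕ, ‖(2 : ℚ_[2]) ^ k‖ ≤ 1 := fun k => by
    rw [norm_pow, padic_norm_two]
    exact pow_le_one₀ (by norm_num) (by norm_num)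
  induction hv using Submodule.span_induction with
  | mem x hx => exact ⟨0, by simpa using hx⟩
  | zero => exact ⟨0, by simp⟩
  | add x y _ _ hx hy =>
    obtain ⟨k, hk⟩ := hx
    obtain ⟨l, hl⟩ := hy
    refine ⟨k + l, ?_⟩
    have : (2 : ℚ_[2]) ^ (k + l) • (x + y) =
        (2 : ℚ_[2]) ^ l • (2 : ℚ_[2]) ^ k • x + (2 : ℚ_[2]) ^ k • (2 : ℚ_[2]) ^ l • y := by
      rw [pow_add]; module
    rw [this]
    exact L.add_mem (L.padic_smul_mem (h2 l) hk) (L.padic_smul_mem (h2 k) hl)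
  | smul a x _ hx =>
    obtain ⟨k, hk⟩ := hx
    obtain ⟨l, hl⟩ := pow_unbounded_of_one_lt ‖a‖ (one_lt_two (α := ℝ))
    refine ⟨k + l, ?_⟩
    have : (2 : ℚ_[2]) ^ (k + l) • a • x = (2 ^ l * a) • (2 : ℚ_[2]) ^ k • x := by
      rw [pow_add]; module
    rw [this]
    refine L.padic_smul_mem ?_ hk
    rw [norm_mul, norm_pow, padic_norm_two, inv_pow, inv_mul_le_one₀ (by positivity)]
    exact hl.le

/-- The lengths of vectors with odd complement form a union of classes modulo `4`. -/
theorem Submodule.exists_orthogonal_pair_of_modEq {q : QuadraticForm ℚ_[2] V}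
    (L : Submodule ℤ_[2] V) {x z : V} (hx : x ∈ L) (hz : z ∈ L) (hxz : Bq q x z = 0)
    {a b u : ℤ_[2]} (ha : IsUnit a) (hb : IsUnit b) (hqx : q x = a) (hqz : q z = b)
    (h : 2 * PadicInt.toZModPow 3 a = 2 * PadicInt.toZModPow 3 u) :
    ∃ x ∈ L, ∃ z ∈ L, Bq q x z = 0 ∧ q x = u ∧ ‖q z‖ = 1 := by
  have hb1 : ‖(b : ℚ_[2])‖ = 1 := PadicInt.isUnit_iff.1 hb
  have scale : ∀ x' ∈ L, ∀ z' ∈ L, Bq q x' z' = 0 → ‖q z'‖ = 1 → ∀ a' : ℤ_[2], q x' = a' →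
      IsUnit a' → PadicInt.toZModPow 3 a' = PadicInt.toZModPow 3 u →
      ∃ x ∈ L, ∃ z ∈ L, Bq q x z = 0 ∧ q x = u ∧ ‖q z‖ = 1 := by
    intro x' hx' z' hz' hxz' hqz' a' hqx' ha' hau
    obtain ⟨s, hs⟩ := PadicInt.exists_sq_mul_eq_of_toZModPow_eq ha' hau
    refine ⟨(s : ℚ_[2]) • x', L.padic_smul_mem s.2 hx', z', hz', ?_, ?_, hqz'⟩
    · rw [Bq_smul_left, hxz', mul_zero]
    · rw [quadraticForm_smul, hqx', ← hs]
      push_cast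
      ring
  rcases ZMod.eq_or_add_four_mul_eq _ _ _ (hb.map (PadicInt.toZModPow 3)) h with h | h
  · exact scale x hx z hz hxz (by rw [hqz, hb1]) a hqx ha h
  · have h4 : ‖(4 * b : ℚ_[2])‖ < 1 := by
      rw [norm_mul, hb1, (by norm_num : (4 : ℚ_[2]) = 2 * 2), norm_mul, padic_norm_two]
      norm_num
    have ha1 : ‖(a : ℚ_[2])‖ = 1 := PadicInt.isUnit_iff.1 ha
    refine scale (x + (2 : ℚ_[2]) • z) ?_ ((a : ℚ_[2]) • z - (2 * b : ℚ_[2]) • x) ?_ ?_ ?_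
      (a + 4 * b) ?_ ?_ ?_
    · exact L.add_mem hx (L.padic_smul_mem (by rw [padic_norm_two]; norm_num) hz)
    · refine L.sub_mem (L.padic_smul_mem a.2 hz) (L.padic_smul_mem ?_ hx)
      rw [norm_mul, hb1, padic_norm_two]
      norm_num
    · simp only [Bq_add_left, Bq_sub_right, Bq_smul_left, Bq_smul_right, Bq_self, hqx, hqz, hxz,
        Bq_comm q z x]
      ring
    · have : q ((a : ℚ_[2]) • z - (2 * b : ℚ_[2]) • x) = a * b * (a + 4 * b) := by
        rw [map_sub_eq_add_sub_two_mul_Bq, quadraticForm_smul, quadraticForm_smul, Bq_smul_left,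
          Bq_smul_right, Bq_comm q z x, hxz, hqx, hqz]
        ring
      rw [this, norm_mul, norm_mul, ha1, hb1, padic_norm_add_eq_one ha1 h4]
      norm_num
    · rw [map_add_eq_add_two_mul_Bq, quadraticForm_smul, Bq_smul_right, hxz, hqx, hqz,
        PadicInt.coe_add, PadicInt.coe_mul, PadicInt.coe_ofNat']
      ring
    · rw [PadicInt.isUnit_iff, PadicInt.norm_def, PadicInt.coe_add, PadicInt.coe_mul,
        PadicInt.coe_ofNat']
      exact padic_norm_add_eq_one ha1 h4
    · rw [← h, map_add, map_mul, map_ofNat]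

namespace IsUnimodularLattice

variable {q : QuadraticForm ℚ_[2] V} {L : Submodule ℤ_[2] V} (hL : IsUnimodularLattice q L)
include hL

theorem norm_Bq_le {x y : V} (hx : x ∈ L) (hy : y ∈ L) : ‖Bq q x y‖ ≤ 1 :=
  (hL.unimodular x).2 hx y hy

theorem norm_le {x : V} (hx : x ∈ L) : ‖q x‖ ≤ 1 := by
  rw [← Bq_self]
  exact hL.norm_Bq_le hx hx

theorem mem_of_norm_Bq_le {x : V} (h : ∀ y ∈ L, ‖Bq q x y‖ ≤ 1) : x ∈ L :=
  (hL.unimodular x).1 h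

theorem orthLattice {x : V} (hx : x ∈ L) (hqx : ‖q x‖ = 1) :
    IsUnimodularLattice (orthForm q x) (orthLattice q L x) := by
  have hx0 : q x ≠ 0 := norm_ne_zero_iff.1 (by rw [hqx]; exact one_ne_zero)
  have hproj : ∀ (v : orthVec q x) (y : V), Bq q v (orthProj q x hx0 y) = Bq q v y := by
    intro v y
    rw [coe_orthProj, Bq_sub_right, Bq_smul_right, Bq_comm q v x, (mem_orthVec q).1 v.2, mul_zero,
      sub_zero]
  refine ⟨fun v hv => ?_, fun v => hL.absorbs v, fun v => ⟨fun hv => ?_, fun hv y hy => ?_⟩⟩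
  · refine Subtype.ext (hL.nondegenerate v fun y => ?_)
    rw [← hproj v y]
    exact hv _
  · refine hL.mem_of_norm_Bq_le fun y hy => ?_
    change ‖Bq q (v : V) y‖ ≤ 1
    rw [← hproj v y]
    refine hv (orthProj q x hx0 y) ?_
    rw [mem_orthLattice, coe_orthProj]
    refine L.sub_mem hy (L.padic_smul_mem ?_ hx)
    rw [norm_mul, norm_inv, hqx, inv_one, one_mul]
    exact hL.norm_Bq_le hx hy
  · exact hL.norm_Bq_le hv hy

theorem exists_norm_Bq_eq_one [Nontrivial V] : ∃ u ∈ L, ∃ v ∈ L, ‖Bq q u v‖ = 1 := by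
  by_contra! h
  have half : ∀ u ∈ L, (2 : ℚ_[2])⁻¹ • u ∈ L := fun u hu =>
    hL.mem_of_norm_Bq_le fun y hy => by
      rw [Bq_smul_left]
      exact padic_norm_half_mul_le_one (lt_of_le_of_ne (hL.norm_Bq_le hu hy) (h u hu y hy))
  have halves : ∀ (k : ℕ), ∀ u ∈ L, (2 : ℚ_[2])⁻¹ ^ k • u ∈ L := by
    intro k
    induction k with
    | zero => intro u hu; simpa using hu
    | succ k ih =>
      intro u hu
      rw [pow_succ, mul_smul]
      exact ih _ (half u hu)
  obtain ⟨v, hv⟩ := exists_ne (0 : V)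
  obtain ⟨w, hw⟩ : ∃ w, Bq q v w ≠ 0 := by
    by_contra! h0
    exact hv (hL.nondegenerate v h0)
  obtain ⟨k, hk⟩ := hL.absorbs v
  obtain ⟨l, hl⟩ := hL.absorbs w
  have hc : 0 < ‖Bq q v w‖ := norm_pos_iff.2 hw
  obtain ⟨m, hm⟩ := pow_unbounded_of_one_lt ‖Bq q v w‖⁻¹ (one_lt_two (α := ℝ))
  have hvm := halves (m + l) _ (by simpa [smul_smul, ← mul_pow] using halves k _ hk : v ∈ L)
  have := hL.norm_Bq_le hvm hl
  rw [Bq_smul_left, Bq_smul_right, pow_add] at this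
  have e : (2 : ℚ_[2])⁻¹ ^ m * 2⁻¹ ^ l * (2 ^ l * Bq q v w) = 2⁻¹ ^ m * Bq q v w := by
    have : (2 : ℚ_[2])⁻¹ ^ l * 2 ^ l = 1 := by rw [← mul_pow]; norm_num
    linear_combination 2⁻¹ ^ m * Bq q v w * this
  rw [e, norm_mul, norm_pow, norm_inv, padic_norm_two, inv_inv] at this
  rw [inv_lt_iff_one_lt_mul₀ hc] at hm
  linarith

/-- An odd unimodular lattice of rank at least two contains two orthogonal vectors of odd
length. -/
theorem exists_orthogonal_pair [FiniteDimensional ℚ_[2] V] (hodd : ∃ x ∈ L, ‖q x‖ = 1)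
    (hn : 2 ≤ Module.finrank ℚ_[2] V) :
    ∃ x ∈ L, ∃ z ∈ L, Bq q x z = 0 ∧ ‖q x‖ = 1 ∧ ‖q z‖ = 1 := by
  obtain ⟨x, hx, hqx⟩ := hodd
  by_cases hz : ∃ z ∈ L, Bq q x z = 0 ∧ ‖q z‖ = 1
  · obtain ⟨z, hz, hxz, hqz⟩ := hz
    exact ⟨x, hx, z, hz, hxz, hqx, hqz⟩
  push Not at hz
  have heven : ∀ z ∈ L, Bq q x z = 0 → ‖q z‖ < 1 := fun z hzL h =>
    lt_of_le_of_ne (hL.norm_le hzL) (hz z hzL h)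
  have hx0 : q x ≠ 0 := norm_ne_zero_iff.1 (by rw [hqx]; exact one_ne_zero)
  have hrank := finrank_orthVec q hx0
  have : Nontrivial (orthVec q x) := Module.nontrivial_of_finrank_pos (R := ℚ_[2]) (by lia)
  obtain ⟨u, hu, v, hv, huv⟩ := (hL.orthLattice hx hqx).exists_norm_Bq_eq_one
  rw [Bq_orthForm] at huv
  rw [mem_orthLattice] at hu hv
  obtain ⟨u, hxu⟩ := u
  obtain ⟨v, hxv⟩ := v
  rw [mem_orthVec] at hxu hxv
  dsimp only at hu hv huv
  have hq' : ‖q (x + u)‖ = 1 := by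
    rw [map_add_eq_add_two_mul_Bq, hxu, mul_zero, add_zero]
    exact padic_norm_add_eq_one hqx (heven u hu hxu)
  have hB : Bq q (x + u) v = Bq q u v := by rw [Bq_add_left, hxv, zero_add]
  refine ⟨x + u, L.add_mem hx hu, q (x + u) • v - Bq q (x + u) v • (x + u),
    L.sub_mem (L.padic_smul_mem hq'.le hv) (L.padic_smul_mem ?_ (L.add_mem hx hu)), ?_, hq', ?_⟩
  · rw [hB, huv]
  · rw [Bq_sub_right, Bq_smul_right, Bq_smul_right, Bq_self]
    ring
  · have : q (q (x + u) • v - Bq q (x + u) v • (x + u)) =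
        -q (x + u) * (Bq q u v * Bq q u v + -(q (x + u) * q v)) := by
      rw [map_sub_eq_add_sub_two_mul_Bq, quadraticForm_smul, quadraticForm_smul, Bq_smul_left,
        Bq_smul_right, Bq_comm q v, hB]
      ring
    rw [this, norm_mul, norm_neg, hq', one_mul]
    refine padic_norm_add_eq_one (by rw [norm_mul, huv, one_mul]) ?_
    rw [norm_neg, norm_mul, hq', one_mul]
    exact heven v hv hxv

theorem exists_orthogonal_triple [FiniteDimensional ℚ_[2] V] (hodd : ∃ x ∈ L, ‖q x‖ = 1)
    (hn : 3 ≤ Module.finrank ℚ_[2] V) :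
    ∃ x ∈ L, ∃ y ∈ L, ∃ z ∈ L, Bq q x y = 0 ∧ Bq q x z = 0 ∧ Bq q y z = 0 ∧
      ‖q x‖ = 1 ∧ ‖q y‖ = 1 ∧ ‖q z‖ = 1 := by
  obtain ⟨x, hx, w, hw, hxw, hqx, hqw⟩ := hL.exists_orthogonal_pair hodd (by lia)
  have hx0 : q x ≠ 0 := norm_ne_zero_iff.1 (by rw [hqx]; exact one_ne_zero)
  have hrank := finrank_orthVec q hx0
  obtain ⟨y, hy, z, hz, hyz, hqy, hqz⟩ := (hL.orthLattice hx hqx).exists_orthogonal_pair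
    ⟨⟨w, (mem_orthVec q).2 hxw⟩, hw, hqw⟩ (by lia)
  exact ⟨x, hx, y, hy, z, hz, (mem_orthVec q).1 y.2, (mem_orthVec q).1 z.2, hyz, hqx, hqy, hqz⟩

theorem exists_orthogonal_quadruple [FiniteDimensional ℚ_[2] V] (hodd : ∃ x ∈ L, ‖q x‖ = 1)
    (hn : 4 ≤ Module.finrank ℚ_[2] V) :
    ∃ x ∈ L, ∃ y ∈ L, ∃ z ∈ L, ∃ w ∈ L, Bq q x y = 0 ∧ Bq q x z = 0 ∧ Bq q y z = 0 ∧
      Bq q x w = 0 ∧ Bq q y w = 0 ∧ Bq q z w = 0 ∧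
      ‖q x‖ = 1 ∧ ‖q y‖ = 1 ∧ ‖q z‖ = 1 ∧ ‖q w‖ = 1 := by
  obtain ⟨x, hx, w, hw, hxw, hqx, hqw⟩ := hL.exists_orthogonal_pair hodd (by lia)
  have hx0 : q x ≠ 0 := norm_ne_zero_iff.1 (by rw [hqx]; exact one_ne_zero)
  have hrank := finrank_orthVec q hx0
  obtain ⟨y, hy, z, hz, w, hw, hyz, hyw, hzw, hqy, hqz, hqw⟩ :=
    (hL.orthLattice hx hqx).exists_orthogonal_triple
      ⟨⟨w, (mem_orthVec q).2 hxw⟩, hw, hqw⟩ (by lia)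
  exact ⟨x, hx, y, hy, z, hz, w, hw, (mem_orthVec q).1 y.2, (mem_orthVec q).1 z.2, hyz,
    (mem_orthVec q).1 w.2, hyw, hzw, hqx, hqy, hqz, hqw⟩

end IsUnimodularLattice

end Lattice

section Isometry

variable {V V' : Type*} [AddCommGroup V] [Module ℚ_[2] V] [AddCommGroup V'] [Module ℚ_[2] V']
  {q : QuadraticForm ℚ_[2] V} {q' : QuadraticForm ℚ_[2] V'}

/-- Witt cancellation of a vector: an isometry of spaces restricts, after a correction, to the
orthogonal complements of two vectors of the same nonzero length. -/
theorem exists_isometry_orthVec {φ : V →ₗ[ℚ_[2]] V'} (hφ : ∀ v, q' (φ v) = q v) {x : V} {y : V'}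
    (hx : q x ≠ 0) (hxy : q x = q' y) :
    ∃ ψ : orthVec q x →ₗ[ℚ_[2]] orthVec q' y, ∀ v, orthForm q' y (ψ v) = orthForm q x v := by
  obtain ⟨τ, hτ, hτx⟩ := exists_isometry_map_eq q' (x := φ x) (y := y) (by rwa [hφ])
    ((hφ x).trans hxy)
  have hτφ : ∀ v, q' ((τ ∘ₗ φ) v) = q v := fun v => (hτ _).trans (hφ v)
  refine ⟨(τ ∘ₗ φ).restrict fun v hv => ?_, fun v => hτφ v⟩
  rw [mem_orthVec, ← hτx, ← (mem_orthVec q).1 hv]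
  exact Bq_map_of_isometry q hτφ x v

/-- Extend an isometry between the orthogonal complements of `x` and `y` by `x ↦ y`. -/
noncomputable def extendIsometry {x : V} {y : V'} (hx : q x ≠ 0)
    (g : orthVec q x →ₗ[ℚ_[2]] orthVec q' y) : V →ₗ[ℚ_[2]] V' :=
  ((q x)⁻¹ • QuadraticMap.associated q x).smulRight y +
    (orthVec q' y).subtype ∘ₗ g ∘ₗ orthProj q x hx

theorem extendIsometry_apply {x : V} {y : V'} (hx : q x ≠ 0)
    (g : orthVec q x →ₗ[ℚ_[2]] orthVec q' y) (v : V) :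
    extendIsometry hx g v = ((q x)⁻¹ * Bq q x v) • y + g (orthProj q x hx v) := by
  simp [extendIsometry, ← Bq_eq_associated]

theorem map_extendIsometry {x : V} {y : V'} (hx : q x ≠ 0) (hxy : q x = q' y)
    {g : orthVec q x →ₗ[ℚ_[2]] orthVec q' y} (hg : ∀ v, orthForm q' y (g v) = orthForm q x v)
    (v : V) : q' (extendIsometry hx g v) = q v := by
  have h := hg (orthProj q x hx v)
  rw [orthForm_apply, orthForm_apply] at h
  rw [extendIsometry_apply, map_add_eq_add_two_mul_Bq, quadraticForm_smul, Bq_smul_left,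
    (mem_orthVec q').1 (g _).2, h, ← hxy, map_eq_of_orthProj q x hx v]
  field_simp
  ring

end Isometry

section Main

theorem exists_common_length {V V' : Type*} [AddCommGroup V] [Module ℚ_[2] V] [Module ℤ_[2] V]
    [IsScalarTower ℤ_[2] ℚ_[2] V] [FiniteDimensional ℚ_[2] V]
    [AddCommGroup V'] [Module ℚ_[2] V'] [Module ℤ_[2] V']
    [IsScalarTower ℤ_[2] ℚ_[2] V'] [FiniteDimensional ℚ_[2] V']
    {q : QuadraticForm ℚ_[2] V} {q' : QuadraticForm ℚ_[2] V'}
    {L : Submodule ℤ_[2] V} {M : Submodule ℤ_[2] V'}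
    (hL : IsUnimodularLattice q L) (hM : IsUnimodularLattice q' M)
    (hLodd : ∃ x ∈ L, ‖q x‖ = 1) (hModd : ∃ x ∈ M, ‖q' x‖ = 1)
    (hn : 2 ≤ Module.finrank ℚ_[2] V)
    (hn' : Module.finrank ℚ_[2] V' = Module.finrank ℚ_[2] V)
    {φ : V →ₗ[ℚ_[2]] V'} (hφ : ∀ v, q' (φ v) = q v) :
    ∃ x ∈ L, ∃ z ∈ L, ∃ y ∈ M, ∃ w ∈ M, Bq q x z = 0 ∧ Bq q' y w = 0 ∧
      q x = q' y ∧ ‖q x‖ = 1 ∧ ‖q z‖ = 1 ∧ ‖q' w‖ = 1 := by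
  by_contra hcon
  have neg : ∀ x ∈ L, ∀ z ∈ L, ∀ y ∈ M, ∀ w ∈ M, Bq q x z = 0 → Bq q' y w = 0 →
      ‖q z‖ = 1 → ‖q' w‖ = 1 → ∀ a c : ℤ_[2], IsUnit a → IsUnit c → (a : ℚ_[2]) = q x →
      (c : ℚ_[2]) = q' y → NegModFour a c := by
    intro x hx z hz y hy w hw hxz hyw hqz hqw a c ha hc hax hcy
    rcases ZMod.two_mul_eq_or_eq_neg_of_isUnit _ _ (ha.map (PadicInt.toZModPow 3))
      (hc.map (PadicInt.toZModPow 3)) with h | h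
    · exfalso
      obtain ⟨b, hb, hbz⟩ := PadicInt.exists_isUnit_coe_eq hqz
      obtain ⟨x₁, hx₁, z₁, hz₁, hxz₁, hqx₁, hqz₁⟩ :=
        L.exists_orthogonal_pair_of_modEq hx hz hxz ha hb hax.symm hbz.symm h
      exact hcon ⟨x₁, hx₁, z₁, hz₁, y, hy, w, hw, hxz₁, hyw, hqx₁.trans hcy,
        by rw [hqx₁]; exact PadicInt.isUnit_iff.1 hc, hqz₁, hqw⟩
    · exact h
  have ne_zero : ∀ t : ℚ_[2], ‖t‖ = 1 → t ≠ 0 := fun t ht =>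
    norm_ne_zero_iff.1 (by rw [ht]; exact one_ne_zero)
  obtain h2 | h3 | h4 : Module.finrank ℚ_[2] V = 2 ∨ Module.finrank ℚ_[2] V = 3 ∨
    4 ≤ Module.finrank ℚ_[2] V := by lia
  · obtain ⟨x, hx, z, hz, hxz, hqx, hqz⟩ := hL.exists_orthogonal_pair hLodd hn
    obtain ⟨y, hy, w, hw, hyw, hqy, hqw⟩ := hM.exists_orthogonal_pair hModd (by lia)
    obtain ⟨a, ha, hax⟩ := PadicInt.exists_isUnit_coe_eq hqx
    obtain ⟨b, hb, hbz⟩ := PadicInt.exists_isUnit_coe_eq hqz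
    obtain ⟨c, hc, hcy⟩ := PadicInt.exists_isUnit_coe_eq hqy
    have hzx : Bq q z x = 0 := by rw [Bq_comm, hxz]
    have hac := neg x hx z hz y hy w hw hxz hyw hqz hqw a c ha hc hax hcy
    have hbc := neg z hz x hx y hy w hw hzx hyw hqx hqw b c hb hc hbz hcy
    have hφxz : Bq q' (φ x) (φ z) = 0 := by rw [Bq_map_of_isometry q hφ, hxz]
    obtain ⟨e, he⟩ := exists_basis_of_orthogonal q' ![φ x, φ z] (hn'.trans h2)
      (by
        intro i j hij
        fin_cases i <;> fin_cases j <;> first | exact absurd rfl hij | skip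
        · exact hφxz
        · exact (Bq_comm _ _ _).trans hφxz)
      (by
        intro i
        fin_cases i
        · exact ne_zero _ ((congrArg norm (hφ x)).trans hqx)
        · exact ne_zero _ ((congrArg norm (hφ z)).trans hqz))
    have hsum := e.sum_repr y
    rw [Fin.sum_univ_two, he] at hsum
    refine NegModFour.binary_ne hc hac hbc (e.repr y 0) (e.repr y 1) ?_
    rw [hcy, hax, hbz]
    conv_rhs => rw [← hsum]
    simp [map_add_eq_add_two_mul_Bq, quadraticForm_smul, Bq_smul_left, Bq_smul_right, hφxz, hφ]
  · obtain ⟨x₀, h₀, x₁, h₁, x₂, h₂, h01, h02, h12, hq0, hq1, hq2⟩ :=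
      hL.exists_orthogonal_triple hLodd h3.ge
    obtain ⟨y₀, k₀, y₁, k₁, y₂, k₂, k01, k02, k12, kq0, kq1, kq2⟩ :=
      hM.exists_orthogonal_triple hModd (hn'.trans h3).ge
    have hx : ∀ i, ‖q (![x₀, x₁, x₂] i)‖ = 1 := by
      intro i; fin_cases i <;> assumption
    have hy : ∀ i, ‖q' (![y₀, y₁, y₂] i)‖ = 1 := by
      intro i; fin_cases i <;> assumption
    have hxL : ∀ i, ![x₀, x₁, x₂] i ∈ L := by
      intro i; fin_cases i <;> assumption
    have hyM : ∀ i, ![y₀, y₁, y₂] i ∈ M := by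
      intro i; fin_cases i <;> assumption
    have ho := Bq_triple_eq_zero q h01 h02 h12
    have ko := Bq_triple_eq_zero q' k01 k02 k12
    generalize ![x₀, x₁, x₂] = x at hx hxL ho
    generalize ![y₀, y₁, y₂] = y at hy hyM ko
    choose a ha hax using fun i => PadicInt.exists_isUnit_coe_eq (hx i)
    choose c hc hcy using fun i => PadicInt.exists_isUnit_coe_eq (hy i)
    have hne : ∀ i : Fin 3, ∃ j, i ≠ j := by decide
    have key : ∀ i j, NegModFour (a i) (c j) := by
      intro i j
      obtain ⟨i', hi⟩ := hne i
      obtain ⟨j', hj⟩ := hne j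
      exact neg _ (hxL i) _ (hxL i') _ (hyM j) _ (hyM j') (ho _ _ hi) (ko _ _ hj) (hx i') (hy j')
        _ _ (ha i) (hc j) (hax i) (hcy j)
    obtain ⟨p, hp : p * p * ∏ i : Fin 3, q' (φ (x i)) = ∏ i : Fin 3, q' (y i)⟩ :=
      exists_sq_mul_prod_eq_of_orthogonal q' (φ ∘ x) y (hn'.trans h3)
      (fun i j hij => (Bq_map_of_isometry q hφ _ _).trans (ho i j hij)) ko
      (fun i => ne_zero _ ((congrArg norm (hφ (x i))).trans (hx i))) (fun i => ne_zero _ (hy i))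
    refine NegModFour.ternary_det_ne ha hc key p ?_
    simp only [hφ, ← hax, ← hcy, Fin.prod_univ_three] at hp
    push_cast
    exact hp
  · obtain ⟨x, hx, y, hy, z, hz, w, hw, hxy, hxz, hyz, hxw, hyw, hzw, hqx, hqy, hqz, hqw⟩ :=
      hL.exists_orthogonal_quadruple hLodd h4
    obtain ⟨s, hs, t, ht, hst, hqs, hqt⟩ := hM.exists_orthogonal_pair hModd (by lia)
    obtain ⟨a, ha, hax⟩ := PadicInt.exists_isUnit_coe_eq hqx
    obtain ⟨b, hb, hby⟩ := PadicInt.exists_isUnit_coe_eq hqy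
    obtain ⟨d, hd, hdz⟩ := PadicInt.exists_isUnit_coe_eq hqz
    obtain ⟨c, hc, hcs⟩ := PadicInt.exists_isUnit_coe_eq hqs
    have hac := neg x hx w hw s hs t ht hxw hst hqw hqt a c ha hc hax hcs
    have hbc := neg y hy w hw s hs t ht hyw hst hqw hqt b c hb hc hby hcs
    have hdc := neg z hz w hw s hs t ht hzw hst hqw hqt d c hd hc hdz hcs
    have hsum : ((a + b + d : ℤ_[2]) : ℚ_[2]) = q (x + y + z) := by
      simp only [map_add_eq_add_two_mul_Bq, Bq_add_left, hxy, hxz, hyz, ← hax, ← hby, ← hdz]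
      push_cast
      ring
    refine NegModFour.not_sum_three hc hac hbc hdc (neg (x + y + z)
      (L.add_mem (L.add_mem hx hy) hz) w hw s hs t ht ?_ hst hqw hqt _ c ?_ hc hsum hcs)
    · rw [Bq_add_left, Bq_add_left, hxw, hyw, hzw, add_zero, add_zero]
    · exact NegModFour.isUnit_sum_three hc hac hbc hdc

theorem exists_isometry_of_finrank_eq (n : ℕ) : ∀ {V V' : Type*} [AddCommGroup V]
    [Module ℚ_[2] V] [Module ℤ_[2] V]
    [IsScalarTower ℤ_[2] ℚ_[2] V] [FiniteDimensional ℚ_[2] V]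
    [AddCommGroup V'] [Module ℚ_[2] V'] [Module ℤ_[2] V']
    [IsScalarTower ℤ_[2] ℚ_[2] V'] [FiniteDimensional ℚ_[2] V']
    {q : QuadraticForm ℚ_[2] V} {q' : QuadraticForm ℚ_[2] V'}
    {L : Submodule ℤ_[2] V} {M : Submodule ℤ_[2] V'}
    (_ : IsUnimodularLattice q L) (_ : IsUnimodularLattice q' M)
    (_ : ∃ x ∈ L, ‖q x‖ = 1) (_ : ∃ x ∈ M, ‖q' x‖ = 1)
    (_ : Module.finrank ℚ_[2] V = n + 1) (_ : Module.finrank ℚ_[2] V' = n + 1)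
    {φ : V →ₗ[ℚ_[2]] V'} (_ : ∀ v, q' (φ v) = q v),
    ∃ g : V →ₗ[ℚ_[2]] V', (∀ v, q' (g v) = q v) ∧ ∀ v ∈ L, g v ∈ M := by
  induction n with
  | zero =>
    intro V V' _ _ _ _ _ _ _ _ _ _ q q' L M hL hM hLodd hModd hn hn' φ hφ
    refine ⟨φ, hφ, fun v hv => ?_⟩
    obtain ⟨y, hy, hqy⟩ := hModd
    have hy0 : y ≠ 0 := by
      rintro rfl
      simp at hqy
    obtain ⟨c, hc⟩ := (finrank_eq_one_iff_of_nonzero' y hy0).1 hn' (φ v)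
    rw [← hc]
    refine M.padic_smul_mem ?_ hy
    have h := hL.norm_le hv
    rw [← hφ, ← hc, quadraticForm_smul, norm_mul, norm_mul, hqy, mul_one] at h
    nlinarith [norm_nonneg c]
  | succ n ih =>
    intro V V' _ _ _ _ _ _ _ _ _ _ q q' L M hL hM hLodd hModd hn hn' φ hφ
    obtain ⟨x, hx, z, hz, y, hy, w, hw, hxz, hyw, hxy, hqx, hqz, hqw⟩ :=
      exists_common_length hL hM hLodd hModd (by lia) (hn'.trans hn.symm) hφ
    have hx0 : q x ≠ 0 := norm_ne_zero_iff.1 (by rw [hqx]; exact one_ne_zero)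
    have hqy : ‖q' y‖ = 1 := hxy ▸ hqx
    obtain ⟨ψ, hψ⟩ := exists_isometry_orthVec hφ hx0 hxy
    have hr := finrank_orthVec q hx0
    have hr' := finrank_orthVec q' (hxy ▸ hx0)
    obtain ⟨g, hg, hgL⟩ := ih (hL.orthLattice hx hqx) (hM.orthLattice hy hqy)
      ⟨⟨z, (mem_orthVec q).2 hxz⟩, hz, hqz⟩ ⟨⟨w, (mem_orthVec q').2 hyw⟩, hw, hqw⟩
      (by lia) (by lia) hψ
    refine ⟨extendIsometry hx0 g, map_extendIsometry hx0 hxy hg, fun v hv => ?_⟩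
    have hc : ‖(q x)⁻¹ * Bq q x v‖ ≤ 1 := by
      rw [norm_mul, norm_inv, hqx, inv_one, one_mul]
      exact hL.norm_Bq_le hx hv
    rw [extendIsometry_apply]
    refine M.add_mem (M.padic_smul_mem hc hy) (hgL _ ?_)
    rw [mem_orthLattice, coe_orthProj]
    exact L.sub_mem hv (L.padic_smul_mem hc hx)

theorem exists_norm_eq_one_of_not_isEvenLat {V : Type*} [AddCommGroup V] [Module ℚ_[2] V]
    [Module ℤ_[2] V] [IsScalarTower ℤ_[2] ℚ_[2] V] {q : QuadraticForm ℚ_[2] V}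
    {L : Submodule ℤ_[2] V} (hL : IsUnimodularLattice q L) (hodd : ¬ IsEvenLat q L) :
    ∃ x ∈ L, ‖q x‖ = 1 := by
  by_contra! h
  refine hodd fun x hx => ?_
  rw [IsIntegral2, div_eq_inv_mul]
  exact padic_norm_half_mul_le_one (lt_of_le_of_ne (hL.norm_le hx) (h x hx))

end Main

/-- There is at most one isomorphism class of odd unimodular lattices in a quadratic space
`(V, q)` over `ℚ₂` of dimension `d ≥ 3`: any two odd unimodular lattices are carried onto each
other by an isometry of `(V, q)`. -/
theorem odd_unimodular_lattices_isometric
    {V : Type*} [AddCommGroup V] [Module ℚ_[2] V] [Module ℤ_[2] V]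
    [IsScalarTower ℤ_[2] ℚ_[2] V] [FiniteDimensional ℚ_[2] V]
    (d : ℕ) (hd : 3 ≤ d) (hdim : Module.finrank ℚ_[2] V = d)
    (q : QuadraticForm ℚ_[2] V)
    (hnd : ∀ x : V, (∀ y : V, Bq q x y = 0) → x = 0)
    (L M : Submodule ℤ_[2] V) (hL : IsLattice L) (hM : IsLattice M)
    (hLu : IsUnimodular q L) (hMu : IsUnimodular q M)
    (hLodd : ¬ IsEvenLat q L) (hModd : ¬ IsEvenLat q M) :
    ∃ g : V ≃ₗ[ℚ_[2]] V, (∀ x : V, q (g x) = q x) ∧ ⇑g '' (L : Set V) = (M : Set V) := by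
  have hL' : IsUnimodularLattice q L := ⟨hnd, Submodule.absorbs_of_span_eq_top hL.2, hLu⟩
  have hM' : IsUnimodularLattice q M := ⟨hnd, Submodule.absorbs_of_span_eq_top hM.2, hMu⟩
  obtain ⟨n, rfl⟩ : ∃ n, d = n + 1 := ⟨d - 1, by lia⟩
  obtain ⟨g, hg, hgL⟩ := exists_isometry_of_finrank_eq n hL' hM'
    (exists_norm_eq_one_of_not_isEvenLat hL' hLodd)
    (exists_norm_eq_one_of_not_isEvenLat hM' hModd) hdim hdim (φ := LinearMap.id) fun _ => rfl
  have hinj : Function.Injective g := by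
    rw [injective_iff_map_eq_zero]
    intro x hx
    refine hnd x fun y => ?_
    rw [← Bq_map_of_isometry q hg, hx]
    simp [Bq]
  refine ⟨LinearEquiv.ofInjectiveEndo g hinj, hg, Set.Subset.antisymm ?_ fun y hy => ?_⟩
  · rintro _ ⟨v, hv, rfl⟩
    exact hgL v hv
  · obtain ⟨x, rfl⟩ := (LinearEquiv.ofInjectiveEndo g hinj).surjective y
    refine ⟨x, hL'.mem_of_norm_Bq_le fun v hv => ?_, rfl⟩
    rw [← Bq_map_of_isometry q hg]
    exact hM'.norm_Bq_le hy (hgL v hv)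
end

section
/- Let (V,q) be a quadratic space over ℚ₂ of dimension d ≥ 3, and let L be an even unimodular lattice in (V,q). Then L is a maximal lattice in (V, ½q): the form ½q takes values in ℤ₂ on L, and there is no lattice strictly containing L on which ½q takes values in ℤ₂. -/
/-- `L` is a maximal lattice for the form `q'` on `V`: `q'` takes values in `ℤ₂` on `L`
and on no lattice strictly containing `L`. -/
def IsMaximalLat {V : Type*} [AddCommGroup V] [Module ℚ_[2] V] [Module ℤ_[2] V]
    [IsScalarTower ℤ_[2] ℚ_[2] V] (q' : V → ℚ_[2]) (L : Submodule ℤ_[2] V) : Prop :=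
  (∀ x ∈ L, IsIntegral2 (q' x)) ∧
    ∀ M : Submodule ℤ_[2] V, IsLattice M → L < M → ¬ (∀ x ∈ M, IsIntegral2 (q' x))

/-- An even unimodular lattice `L` in a quadratic space `(V, q)` over `ℚ₂` of dimension
`d ≥ 3` is a maximal lattice in `(V, ½q)`: the form `½q` is `ℤ₂`-valued on `L` and there is
no lattice strictly containing `L` on which `½q` is `ℤ₂`-valued. -/
theorem even_unimodular_is_maximal_for_half_q
    {V : Type*} [AddCommGroup V] [Module ℚ_[2] V] [Module ℤ_[2] V]
    [IsScalarTower ℤ_[2] ℚ_[2] V] [FiniteDimensional ℚ_[2] V]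
    (d : ℕ) (hd : 3 ≤ d) (hdim : Module.finrank ℚ_[2] V = d)
    (q : QuadraticForm ℚ_[2] V)
    (hnd : ∀ x : V, (∀ y : V, Bq q x y = 0) → x = 0)
    (L : Submodule ℤ_[2] V) (hL : IsLattice L)
    (hLu : IsUnimodular q L) (hLe : IsEvenLat q L) :
    IsMaximalLat (fun x : V => q x / 2) L := by
  have norm_sub_le_one : ∀ a b : ℚ_[2], ‖a‖ ≤ 1 → ‖b‖ ≤ 1 → ‖a - b‖ ≤ 1 := fun a b ha hb =>
    (PadicInt.subring 2).sub_mem ha hb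
  refine ⟨hLe, fun M _ hLM hM => hLM.not_ge fun x hx => (hLu x).1 fun y hy => ?_⟩
  have hy' := hLM.le hy
  unfold IsIntegral2 at hM ⊢
  rw [Bq, sub_div, sub_div]
  exact norm_sub_le_one _ _
    (norm_sub_le_one _ _ (hM _ (M.add_mem hx hy')) (hM x hx)) (hM y hy')
end

section
/- Let (V,q) be a quadratic space over ℚ₂ of odd dimension d ≥ 3, let L be an odd unimodular lattice in (V,q), let Λ = {x ∈ L : q(x) ∈ 2ℤ₂}, and let Λ* = {x ∈ V : B_q(x,Λ) ⊆ ℤ₂} be the dual of Λ. Then the quotient group Λ*/Λ is isomorphic to ℤ/4ℤ. -/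
/-- An alternating matrix of odd size over `ZMod 2` (zero diagonal, symmetric) is singular. -/
theorem Matrix.det_eq_zero_of_alternating_zmod_two {ι : Type*} [Fintype ι] [DecidableEq ι]
    (hι : Odd (Fintype.card ι)) (M : Matrix ι ι (ZMod 2)) (hM : M.IsSymm)
    (hdiag : ∀ i, M i i = 0) : M.det = 0 := by
  let r : LinearOrder ι := LinearOrder.lift' (Fintype.equivFin ι) (Fintype.equivFin ι).injective
  let A : Matrix ι ι ℤ := Matrix.of fun i j =>
    if r.lt i j then ((M i j).val : ℤ) else if r.lt j i then -((M i j).val : ℤ) else 0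
  have hA : A.transpose = -A := by
    ext i j
    simp only [Matrix.transpose_apply, Matrix.neg_apply, A, Matrix.of_apply, hM.apply i j]
    rcases lt_trichotomy i j with h | h | h
    · rw [if_neg h.not_gt, if_pos h, if_pos h]
    · subst h; simp
    · rw [if_pos h, if_neg h.not_gt, if_pos h]; simp
  have hdet : A.det = 0 := by
    have h := Matrix.det_transpose A
    rw [hA, Matrix.det_neg, hι.neg_one_pow] at h
    linarith
  have hmap : (Int.castRingHom (ZMod 2)).mapMatrix A = M := by
    ext i j
    simp only [RingHom.mapMatrix_apply, Matrix.map_apply, A, Matrix.of_apply]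
    rcases lt_trichotomy i j with h | h | h
    · rw [if_pos h]; simp
    · subst h; simp [hdiag]
    · rw [if_neg h.not_gt, if_pos h]; simp [ZMod.neg_eq_self_mod_two]
  rw [← hmap, ← RingHom.map_det, hdet, map_zero]

/-- A nondegenerate symmetric matrix `G` of odd size over `ZMod 2` admits a characteristic vector
`w`, and `w` has norm `1`. -/
theorem Matrix.exists_characteristic_of_odd_card {ι : Type*} [Fintype ι] [DecidableEq ι]
    (hι : Odd (Fintype.card ι)) (G : Matrix ι ι (ZMod 2)) (hG : G.IsSymm)
    (hinj : ∀ v, G.mulVec v = 0 → v = 0) :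
    ∃ w, G.mulVec w = G.diag ∧ G.diag ⬝ᵥ w = 1 := by
  have hsq : ∀ a : ZMod 2, a + a * a = 0 := by decide
  have hone : ∀ a : ZMod 2, a ≠ 0 → a = 1 := by decide
  have hdet : (G + Matrix.vecMulVec G.diag G.diag).det = 0 := by
    apply Matrix.det_eq_zero_of_alternating_zmod_two hι
    · ext i j
      simp [Matrix.vecMulVec_apply, hG.apply i j, mul_comm]
    · intro i
      simpa [Matrix.vecMulVec_apply] using hsq (G i i)
  obtain ⟨v, hv0, hv⟩ := Matrix.exists_mulVec_eq_zero_iff.mpr hdet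
  have key : ∀ i, G.mulVec v i = G.diag i * (G.diag ⬝ᵥ v) := by
    intro i
    have h := congrFun hv i
    rw [Matrix.add_mulVec, Matrix.vecMulVec_mulVec] at h
    have h' : G.mulVec v i + G.diag i * (G.diag ⬝ᵥ v) = 0 := by
      simpa [mul_comm] using h
    rw [eq_neg_of_add_eq_zero_left h', ZMod.neg_eq_self_mod_two]
  have h1 : G.diag ⬝ᵥ v = 1 := by
    apply hone
    intro h0
    exact hv0 (hinj v (funext fun i => by simp [key, h0]))
  exact ⟨v, funext fun i => by rw [key, h1, mul_one], h1⟩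

theorem PadicInt.toZMod_two_eq_zero_iff (z : ℤ_[2]) : PadicInt.toZMod z = 0 ↔ (2 : ℤ_[2]) ∣ z := by
  rw [← RingHom.mem_ker, PadicInt.ker_toZMod, PadicInt.maximalIdeal_eq_span_p,
    Ideal.mem_span_singleton, Nat.cast_ofNat]

theorem PadicInt.two_dvd_sub {a b : ℤ_[2]} (ha : ¬ 2 ∣ a) (hb : ¬ 2 ∣ b) : 2 ∣ a - b := by
  rw [← PadicInt.toZMod_two_eq_zero_iff] at *
  rw [map_sub]
  generalize PadicInt.toZMod a = s at *
  generalize PadicInt.toZMod b = t at *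
  revert s t
  decide

theorem PadicInt.toZModPow_two_eq_zero_iff (z : ℤ_[2]) :
    PadicInt.toZModPow 2 z = 0 ↔ (4 : ℤ_[2]) ∣ z := by
  rw [← RingHom.mem_ker, PadicInt.ker_toZModPow, Ideal.mem_span_singleton]
  norm_num

/-- A symmetric bilinear form on a free `ℤ₂`-module of odd rank that is nondegenerate modulo `2`
has a characteristic vector `w` of odd norm. -/
theorem exists_characteristic_of_odd_finrank {L : Type*} [AddCommGroup L] [Module ℤ_[2] L]
    [Module.Free ℤ_[2] L] [Module.Finite ℤ_[2] L] (hodd : Odd (Module.finrank ℤ_[2] L))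
    (β : LinearMap.BilinForm ℤ_[2] L) (hsymm : ∀ x y, β x y = β y x)
    (hβ : ∀ x, (∀ y, 2 ∣ β x y) → ∃ z, x = (2 : ℤ_[2]) • z) :
    ∃ w, (∀ x, 2 ∣ β x x - β x w) ∧ ¬ 2 ∣ β w w := by
  classical
  let e := Module.Free.chooseBasis ℤ_[2] L
  let π : ℤ_[2] →+* ZMod 2 := PadicInt.toZMod
  have hπ : ∀ z, π z = 0 ↔ 2 ∣ z := PadicInt.toZMod_two_eq_zero_iff
  let G := (LinearMap.BilinForm.toMatrix e β).map π
  have hlift : ∀ v : Module.Free.ChooseBasisIndex ℤ_[2] L → ZMod 2, ∃ x : L,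
      (∀ i, π (e.repr x i) = v i) ∧ ∀ i, π (β (e i) x) = G.mulVec v i := by
    intro v
    choose c hc using fun i => ZMod.ringHom_surjective π (v i)
    refine ⟨∑ i, c i • e i, fun i => by simp [Finsupp.single_apply, hc], fun i => ?_⟩
    simp [G, Matrix.mulVec, dotProduct, hc, mul_comm, LinearMap.BilinForm.toMatrix_apply]
  have hspan : ∀ (x : L) (f : L →ₗ[ℤ_[2]] ℤ_[2]), f x = ∑ i, e.repr x i * f (e i) := by
    intro x f
    conv_lhs => rw [← e.sum_repr x, map_sum]
    simp only [map_smul, smul_eq_mul]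
  obtain ⟨v, hv, hv1⟩ := Matrix.exists_characteristic_of_odd_card
    (by rwa [← Module.finrank_eq_card_chooseBasisIndex]) G
    (by ext i j; simp [G, LinearMap.BilinForm.toMatrix_apply, hsymm])
    (by
      intro v hv
      obtain ⟨x, hx, hGx⟩ := hlift v
      obtain ⟨z, rfl⟩ := hβ x (fun y => by
        rw [hsymm]
        rw [← LinearMap.flip_apply, hspan]
        refine Finset.dvd_sum fun i _ => Dvd.dvd.mul_left ?_ _
        rw [LinearMap.flip_apply, ← hπ, hGx, hv, Pi.zero_apply])
      ext i
      rw [← hx, Pi.zero_apply, hπ, map_smul, Finsupp.smul_apply, smul_eq_mul]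
      exact dvd_mul_right _ _)
  obtain ⟨w, hw, hGw⟩ := hlift v
  refine ⟨w, fun x => ?_, fun h => ?_⟩
  · have hx : x ∈ Submodule.span ℤ_[2] (Set.range e) := by simp
    induction hx using Submodule.span_induction with
    | mem x hx =>
      obtain ⟨i, rfl⟩ := hx
      rw [← hπ, map_sub, hGw, hv]
      simp [G, LinearMap.BilinForm.toMatrix_apply]
    | zero => simp
    | add x y _ _ hx hy =>
      convert (hx.add hy).add (dvd_mul_right 2 (β x y)) using 1
      simp only [map_add, LinearMap.add_apply, hsymm y x]
      ring
    | smul a x _ hx =>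
      have ha : 2 ∣ a * a - a := by
        rw [← hπ, map_sub, map_mul]
        generalize π a = t
        revert t
        decide
      convert (hx.mul_left (a * a)).add (ha.mul_right (β x w)) using 1
      simp only [map_smul, LinearMap.smul_apply, smul_eq_mul]
      ring
  · rw [← hπ] at h
    rw [← LinearMap.flip_apply, hspan, map_sum] at h
    simp only [LinearMap.flip_apply, map_mul, hw, hGw, hv] at h
    rw [dotProduct_comm] at hv1
    exact one_ne_zero (hv1.symm.trans h)

theorem padicInt_coe_inj {a b : ℤ_[2]} : (a : ℚ_[2]) = b ↔ a = b :=
  ⟨PadicInt.ext, congrArg _⟩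

theorem isIntegral2_iff {c : ℚ_[2]} : IsIntegral2 c ↔ ∃ z : ℤ_[2], (z : ℚ_[2]) = c :=
  ⟨fun h => ⟨⟨c, h⟩, rfl⟩, fun ⟨z, hz⟩ => hz ▸ z.2⟩

theorem isIntegral2_coe_div_two {z : ℤ_[2]} : IsIntegral2 ((z : ℚ_[2]) / 2) ↔ 2 ∣ z := by
  rw [isIntegral2_iff]
  refine exists_congr fun y => ?_
  rw [eq_div_iff two_ne_zero, ← padicInt_coe_inj]
  change _ ↔ (z : ℚ_[2]) = 2 * y
  rw [eq_comm, mul_comm]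

theorem IsIntegral2.add {a b : ℚ_[2]} (ha : IsIntegral2 a) (hb : IsIntegral2 b) :
    IsIntegral2 (a + b) :=
  (PadicInt.subring 2).add_mem ha hb

theorem IsIntegral2.sub {a b : ℚ_[2]} (ha : IsIntegral2 a) (hb : IsIntegral2 b) :
    IsIntegral2 (a - b) :=
  (PadicInt.subring 2).sub_mem ha hb

theorem IsIntegral2.mul {a b : ℚ_[2]} (ha : IsIntegral2 a) (hb : IsIntegral2 b) :
    IsIntegral2 (a * b) :=
  (PadicInt.subring 2).mul_mem ha hb

theorem associated_eq_Bq {V : Type*} [AddCommGroup V] [Module ℚ_[2] V]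
    (q : QuadraticForm ℚ_[2] V) (x y : V) : QuadraticMap.associated q x y = Bq q x y := by
  rw [QuadraticMap.associated_apply, Bq, Module.End.smul_def,
    QuadraticMap.half_moduleEnd_apply_eq_half_smul, smul_eq_mul, invOf_eq_inv, div_eq_inv_mul]

theorem two_smul_eq {V : Type*} [AddCommGroup V] [Module ℚ_[2] V] [Module ℤ_[2] V]
    (x : V) : (2 : ℤ_[2]) • x = (2 : ℚ_[2]) • x := by
  rw [two_smul, two_smul]

section Lattice

variable {V : Type*} [AddCommGroup V] [Module ℚ_[2] V] [Module ℤ_[2] V]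
  [IsScalarTower ℤ_[2] ℚ_[2] V]

theorem padicInt_smul_eq (a : ℤ_[2]) (x : V) : a • x = (a : ℚ_[2]) • x :=
  (algebraMap_smul ℚ_[2] a x).symm

/-- The `ℤ₂`-valued bilinear form on a unimodular lattice. -/
theorem IsUnimodular.exists_bilinForm {q : QuadraticForm ℚ_[2] V} {L : Submodule ℤ_[2] V}
    (hL : IsUnimodular q L) :
    ∃ β : LinearMap.BilinForm ℤ_[2] L, ∀ x y : L, (β x y : ℚ_[2]) = Bq q x y := by
  have h : ∀ x y : L, ∃ z : ℤ_[2], (z : ℚ_[2]) = Bq q x y := fun x y =>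
    isIntegral2_iff.mp ((hL x).mpr x.2 y y.2)
  choose b hb using h
  refine ⟨LinearMap.mk₂ ℤ_[2] b ?_ ?_ ?_ ?_, hb⟩ <;> intros <;> apply PadicInt.ext <;>
    simp [hb, ← associated_eq_Bq, padicInt_smul_eq]

/-- A unimodular lattice of odd rank contains a characteristic vector of odd norm. -/
theorem IsUnimodular.exists_characteristic [FiniteDimensional ℚ_[2] V]
    (hodd : Odd (Module.finrank ℚ_[2] V)) {q : QuadraticForm ℚ_[2] V} {L : Submodule ℤ_[2] V}
    (hlat : IsLattice L) (hL : IsUnimodular q L) :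
    ∃ w ∈ L, (∀ x ∈ L, IsIntegral2 ((q x - Bq q x w) / 2)) ∧ ¬ IsIntegral2 (q w / 2) := by
  have hinst : Submodule.IsLattice ℚ_[2] L := ⟨hlat.1, hlat.2⟩
  have hfree : Module.Free ℤ_[2] L := Submodule.IsLattice.free ℚ_[2] L
  have hfin : Module.Finite ℤ_[2] L := Submodule.IsLattice.finite ℚ_[2] L
  have hrank : Module.finrank ℤ_[2] L = Module.finrank ℚ_[2] V :=
    congrArg Cardinal.toNat (Submodule.IsLattice.rank' ℚ_[2] L)
  obtain ⟨β, hβ⟩ := hL.exists_bilinForm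
  have hself : ∀ x : L, (β x x : ℚ_[2]) = q x := fun x => by
    rw [hβ, ← associated_eq_Bq, QuadraticMap.associated_eq_self_apply]
  obtain ⟨w, hw, hww⟩ := exists_characteristic_of_odd_finrank (hrank ▸ hodd) β
    (fun x y => PadicInt.ext (by
      rw [hβ, hβ, ← associated_eq_Bq, ← associated_eq_Bq, QuadraticMap.associated_isSymm ℚ_[2]]))
    (fun x hx => by
      have hmem : (2⁻¹ : ℚ_[2]) • (x : V) ∈ L := (hL _).mp fun y hy => by
        have h := isIntegral2_coe_div_two.mpr (hx ⟨y, hy⟩)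
        rw [hβ, ← associated_eq_Bq] at h
        rw [← associated_eq_Bq, map_smul, LinearMap.smul_apply, smul_eq_mul, mul_comm,
          ← div_eq_mul_inv]
        exact h
      refine ⟨⟨_, hmem⟩, Subtype.ext ?_⟩
      simp [two_smul_eq])
  refine ⟨w, w.2, fun x hx => ?_, ?_⟩
  · have h := isIntegral2_coe_div_two.mpr (hw ⟨x, hx⟩)
    rwa [PadicInt.coe_sub, hself, hβ] at h
  · rwa [← hself, isIntegral2_coe_div_two]

end Lattice

/-- Let `(V, q)` over `ℚ₂` have odd dimension `d ≥ 3`, `L` an odd unimodular lattice,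
`Λ = {x ∈ L : q(x) ∈ 2ℤ₂}` and `Λ*` the dual of `Λ`. Then `Λ*/Λ ≅ ℤ/4ℤ`. -/
theorem dual_quotient_odd_dim
    {V : Type*} [AddCommGroup V] [Module ℚ_[2] V] [Module ℤ_[2] V]
    [IsScalarTower ℤ_[2] ℚ_[2] V] [FiniteDimensional ℚ_[2] V]
    (d : ℕ) (hd3 : 3 ≤ d) (hdodd : Odd d) (hdim : Module.finrank ℚ_[2] V = d)
    (q : QuadraticForm ℚ_[2] V)
    (hnd : ∀ x : V, (∀ y : V, Bq q x y = 0) → x = 0)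
    (L : Submodule ℤ_[2] V) (hL : IsLattice L)
    (hLuni : IsUnimodular q L) (hLodd : ¬ IsEvenLat q L)
    (Λ : Submodule ℤ_[2] V)
    (hΛ : (Λ : Set V) = {x : V | x ∈ L ∧ IsIntegral2 (q x / 2)})
    (Λd : Submodule ℤ_[2] V)
    (hΛd : (Λd : Set V) = {x : V | ∀ y ∈ Λ, IsIntegral2 (Bq q x y)}) :
    Nonempty ((↥Λd ⧸ Submodule.comap Λd.subtype Λ) ≃+ ZMod 4) := by
  set B := QuadraticMap.associated (R := ℚ_[2]) q
  have hB : ∀ x y, Bq q x y = B x y := fun x y => (associated_eq_Bq q x y).symm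
  have hsymm : ∀ x y, B x y = B y x := QuadraticMap.associated_isSymm ℚ_[2] q
  have hself : ∀ x, B x x = q x := QuadraticMap.associated_eq_self_apply ℚ_[2] q
  obtain ⟨w, hwL, hw, hww⟩ := hLuni.exists_characteristic (hdim ▸ hdodd) hL
  simp only [hB] at hw
  have memΛ : ∀ x, x ∈ Λ ↔ x ∈ L ∧ IsIntegral2 (q x / 2) := fun x => Set.ext_iff.mp hΛ x
  have memΛd : ∀ x, x ∈ Λd ↔ ∀ y ∈ Λ, IsIntegral2 (B x y) := fun x => by
    have h := Set.ext_iff.mp hΛd x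
    simp only [hB] at h
    exact h
  have memL : ∀ x, x ∈ L ↔ ∀ y ∈ L, IsIntegral2 (B x y) := fun x => by
    simpa only [InDual, hB] using (hLuni x).symm
  have memΛ' : ∀ x, x ∈ Λ ↔ x ∈ L ∧ IsIntegral2 (B x w / 2) := by
    intro x
    rw [memΛ]
    refine and_congr_right fun hx => ⟨fun h => ?_, fun h => ?_⟩
    · convert h.sub (hw x hx) using 1; ring
    · convert h.add (hw x hx) using 1; ring
  obtain ⟨z, hz⟩ := isIntegral2_iff.mp ((memL w).mp hwL w hwL)
  rw [hself] at hz
  have hz2 : ¬ 2 ∣ z := by rwa [← isIntegral2_coe_div_two, hz]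
  have htwo : IsIntegral2 (2 : ℚ_[2]) := isIntegral2_iff.mpr ⟨2, by norm_cast⟩
  have hint : ∀ x : Λd, ∃ z : ℤ_[2], (z : ℚ_[2]) = 2 * B x w := by
    intro x
    rw [← isIntegral2_iff]
    have h2w : (2 : ℤ_[2]) • w ∈ Λ := by
      refine (memΛ' _).mpr ⟨L.smul_mem _ hwL, ?_⟩
      have h := (memL w).mp hwL w hwL
      simpa [two_smul_eq] using h
    simpa [two_smul_eq] using (memΛd x).mp x.2 _ h2w
  choose f hf using hint
  let F : Λd →+ ZMod (2 ^ 2) := AddMonoidHom.mk' (fun x => PadicInt.toZModPow 2 (f x)) (by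
    intro x y
    rw [← map_add]
    congr 1
    apply PadicInt.ext
    rw [PadicInt.coe_add, hf, hf, hf, Submodule.coe_add, map_add, LinearMap.add_apply]
    ring)
  have hF : ∀ x : Λd, F x = 0 ↔ IsIntegral2 (B x w / 2) := by
    intro x
    change PadicInt.toZModPow 2 (f x) = 0 ↔ _
    rw [PadicInt.toZModPow_two_eq_zero_iff, isIntegral2_iff]
    refine exists_congr fun z => ?_
    rw [← padicInt_coe_inj, hf, PadicInt.coe_mul, eq_div_iff two_ne_zero]
    have h4 : ((4 : ℤ_[2]) : ℚ_[2]) = 4 := by norm_cast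
    rw [h4]
    exact ⟨fun h => by linear_combination (-1 / 2 : ℚ_[2]) * h,
      fun h => by linear_combination (-2 : ℚ_[2]) * h⟩
  have hker : F.ker = (Submodule.comap Λd.subtype Λ).toAddSubgroup := by
    ext x
    rw [AddMonoidHom.mem_ker, hF, Submodule.mem_toAddSubgroup, Submodule.mem_comap,
      Submodule.subtype_apply, memΛ']
    refine ⟨fun h => ⟨(memL _).mpr fun y hy => ?_, h⟩, And.right⟩
    by_cases hyΛ : y ∈ Λ
    · exact (memΛd x).mp x.2 y hyΛ
    · have hyw : y - w ∈ Λ := by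
        refine (memΛ' _).mpr ⟨L.sub_mem hy hwL, ?_⟩
        obtain ⟨a, ha⟩ := isIntegral2_iff.mp ((memL y).mp hy w hwL)
        rw [memΛ', and_iff_right hy, ← ha, isIntegral2_coe_div_two] at hyΛ
        rw [map_sub, LinearMap.sub_apply, hself, ← ha, ← hz, ← PadicInt.coe_sub,
          isIntegral2_coe_div_two]
        exact PadicInt.two_dvd_sub hyΛ hz2
      convert ((memΛd x).mp x.2 _ hyw).add (htwo.mul h) using 1
      rw [map_sub]
      ring
  have hsurj : Function.Surjective F := by
    have hmem : (2⁻¹ : ℚ_[2]) • w ∈ Λd := (memΛd _).mpr fun y hy => by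
      have h := ((memΛ' y).mp hy).2
      rw [map_smul, LinearMap.smul_apply, smul_eq_mul, hsymm w y, mul_comm, ← div_eq_mul_inv]
      exact h
    have hne : F ⟨_, hmem⟩ + F ⟨_, hmem⟩ ≠ 0 := by
      rw [← map_add, Ne, hF]
      convert hww using 3
      simp only [Submodule.coe_add, map_add, map_smul, LinearMap.add_apply, LinearMap.smul_apply,
        hself, smul_eq_mul]
      ring
    have hgen : ∀ t : ZMod (2 ^ 2), t + t ≠ 0 → ∀ s, ∃ n : Fin 4, (n : ℕ) • t = s := by decide
    intro s
    obtain ⟨n, hn⟩ := hgen _ hne s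
    exact ⟨(n : ℕ) • ⟨_, hmem⟩, by rw [map_nsmul, hn]⟩
  exact ⟨(QuotientAddGroup.quotientAddEquivOfEq hker.symm).trans
    (QuotientAddGroup.quotientKerEquivOfSurjective F hsurj)⟩
end
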